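/- (Theorem 1, overlap form: smoothing increases overlap across contexts.) Let d ≥ 1, let (𝒜, Σ) be a measurable space, and let p be a Markov kernel from ℝ^d to 𝒜. Fix σ > 0, let γ = N(0, I_d) be the standard Gaussian measure on ℝ^d, and define the Gaussian context-smoothed kernel p_σ(A|c) = ∫ p(A | c + σ·w) dγ(w). Define the overlap between two probability measures P, Q on 𝒜 as Ov(P, Q) = 1 − TV(P, Q). Then for any two contexts c, c' ∈ ℝ^d, Ov(p_σ(·|c), p_σ(·|c')) ≥ 1 − (M_d / σ) · ‖c − c'‖, where M_d = ∫ ‖w‖ dγ(w). In particular, for fixed c, c' this lower bound is nondecreasing in σ, and for fixed σ it is nonincreasing in ‖c − c'‖. -/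

import Mathlib

open MeasureTheory Real

/-- The standard Gaussian measure `N(0, I_d)` on `ℝ^d`, given by its density
`(2π)^{-d/2} exp(-‖w‖²/2)` with respect to Lebesgue measure. -/
noncomputable def stdGaussian (d : ℕ) : Measure (EuclideanSpace ℝ (Fin d)) :=
  (volume : Measure (EuclideanSpace ℝ (Fin d))).withDensity
    (fun w => ENNReal.ofReal ((2 * π) ^ (-(d : ℝ) / 2) * Real.exp (-‖w‖ ^ 2 / 2)))

/-- Total variation distance: `TV(P,Q) = sup_{A measurable} |P(A) − Q(A)|`. -/
noncomputable def TV {𝒜 : Type*} [MeasurableSpace 𝒜] (P Q : Measure 𝒜) : ℝ :=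
  ⨆ A : {A : Set 𝒜 // MeasurableSet A}, |(P A.1).toReal - (Q A.1).toReal|

/-- The Gaussian context-smoothed kernel `p_σ(·|c) = ∫ p(· | c + σ·w) dγ(w)`, as a
measure on the action space, for each context `c`. -/
noncomputable def smoothedKernel (d : ℕ) (σ : ℝ) {𝒜 : Type*} [MeasurableSpace 𝒜]
    (p : ProbabilityTheory.Kernel (EuclideanSpace ℝ (Fin d)) 𝒜)
    (c : EuclideanSpace ℝ (Fin d)) : Measure 𝒜 :=
  (stdGaussian d).bind (fun w => p (c + σ • w))

/-- Overlap between two probability measures: `Ov(P,Q) = 1 − TV(P,Q)`. -/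
noncomputable def Ov {𝒜 : Type*} [MeasurableSpace 𝒜] (P Q : Measure 𝒜) : ℝ :=
  1 - TV P Q

/-- The density of the standard Gaussian measure on `ℝ^d`. -/
noncomputable def gaussianDensity (d : ℕ) (w : EuclideanSpace ℝ (Fin d)) : ℝ :=
  (2 * π) ^ (-(d : ℝ) / 2) * Real.exp (-‖w‖ ^ 2 / 2)

/-- A translate of a `C¹` function is `L¹`-close to the function, with constant the `L¹` norm of
the derivative. -/
lemma lintegral_enorm_translate_sub_le {E : Type*} [NormedAddCommGroup E] [NormedSpace ℝ E]
    [MeasurableSpace E] [BorelSpace E] [SecondCountableTopology E]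
    (μ : Measure E) [SFinite μ] [μ.IsAddRightInvariant] {g : E → ℝ} (hg : ContDiff ℝ 1 g) (h : E) :
    ∫⁻ w, ‖g (w + h) - g w‖ₑ ∂μ ≤ ‖h‖ₑ * ∫⁻ w, ‖fderiv ℝ g w‖ₑ ∂μ := by
  have hcont : Continuous (fderiv ℝ g) := hg.continuous_fderiv one_ne_zero
  have hline (w : E) (t : ℝ) :
      HasDerivAt (fun t : ℝ => g (w + t • h)) (fderiv ℝ g (w + t • h) h) t := by
    have h1 : HasDerivAt (fun t : ℝ => w + t • h) h t := by
      simpa using ((hasDerivAt_id t).smul_const h).const_add w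
    exact ((hg.differentiable one_ne_zero) _).hasFDerivAt.comp_hasDerivAt t h1
  have hpoint (w : E) : ‖g (w + h) - g w‖ₑ
      ≤ ∫⁻ t in Set.Icc (0 : ℝ) 1, ‖h‖ₑ * ‖fderiv ℝ g (w + t • h)‖ₑ := by
    have hcd : ContDiff ℝ 1 (fun t : ℝ => g (w + t • h)) := by fun_prop
    have := enorm_sub_le_lintegral_deriv_of_contDiffOn_Icc (a := 0) (b := 1)
      hcd.contDiffOn zero_le_one
    simp only [one_smul, zero_smul, add_zero] at this
    refine this.trans (lintegral_mono fun t => ?_)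
    rw [(hline w t).deriv, mul_comm]
    exact ContinuousLinearMap.le_opENorm _ _
  calc ∫⁻ w, ‖g (w + h) - g w‖ₑ ∂μ
      ≤ ∫⁻ w, (∫⁻ t in Set.Icc (0 : ℝ) 1, ‖h‖ₑ * ‖fderiv ℝ g (w + t • h)‖ₑ) ∂μ :=
        lintegral_mono hpoint
    _ = ∫⁻ t in Set.Icc (0 : ℝ) 1, ∫⁻ w, ‖h‖ₑ * ‖fderiv ℝ g (w + t • h)‖ₑ ∂μ := by
        apply lintegral_lintegral_swap
        have : Continuous fun x : E × ℝ => ‖fderiv ℝ g (x.1 + x.2 • h)‖ₑ := by fun_prop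
        exact (this.measurable.const_mul _).aemeasurable
    _ = ∫⁻ t in Set.Icc (0 : ℝ) 1, ‖h‖ₑ * ∫⁻ w, ‖fderiv ℝ g w‖ₑ ∂μ := by
        refine lintegral_congr fun t => ?_
        rw [lintegral_const_mul _ (by fun_prop),
          lintegral_add_right_eq_self (fun w => ‖fderiv ℝ g w‖ₑ) (t • h)]
    _ = ‖h‖ₑ * ∫⁻ w, ‖fderiv ℝ g w‖ₑ ∂μ := by simp

section GaussianDensity

variable {d : ℕ}

lemma gaussianDensity_nonneg (w : EuclideanSpace ℝ (Fin d)) : 0 ≤ gaussianDensity d w := by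
  unfold gaussianDensity; positivity

lemma contDiff_gaussianDensity : ContDiff ℝ 1 (gaussianDensity d) := by
  have : ContDiff ℝ 1 fun w : EuclideanSpace ℝ (Fin d) => ‖w‖ ^ 2 := contDiff_norm_sq ℝ
  unfold gaussianDensity
  fun_prop

lemma enorm_fderiv_gaussianDensity_le (w : EuclideanSpace ℝ (Fin d)) :
    ‖fderiv ℝ (gaussianDensity d) w‖ₑ ≤ ENNReal.ofReal (‖w‖ * gaussianDensity d w) := by
  have h1 : HasFDerivAt (fun w : EuclideanSpace ℝ (Fin d) => ‖w‖ ^ 2)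
      (2 • innerSL ℝ w) w := (hasStrictFDerivAt_norm_sq w).hasFDerivAt
  have h2 : HasFDerivAt (gaussianDensity d)
      (-(gaussianDensity d w) • innerSL ℝ w) w := by
    have := ((h1.const_mul (-1 / 2 : ℝ)).exp).const_mul ((2 * π) ^ (-(d : ℝ) / 2))
    have hfun : gaussianDensity d =
        fun y => (2 * π) ^ (-(d : ℝ) / 2) * Real.exp (-1 / 2 * ‖y‖ ^ 2) := by
      ext y; simp only [gaussianDensity]; ring_nf
    rw [hfun]
    refine this.congr_fderiv ?_
    ext v
    simp
    ring
  rw [h2.fderiv, ← ofReal_norm]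
  apply ENNReal.ofReal_le_ofReal
  rw [norm_smul, innerSL_apply_norm, norm_neg, Real.norm_of_nonneg (gaussianDensity_nonneg w),
    mul_comm]

lemma integrable_exp_neg_mul_sq_norm {b : ℝ} (hb : 0 < b) :
    Integrable fun w : EuclideanSpace ℝ (Fin d) => Real.exp (-b * ‖w‖ ^ 2) := by
  have := (GaussianFourier.integrable_cexp_neg_mul_sq_norm_add (b := (b : ℂ)) (by simpa) 0
    (0 : EuclideanSpace ℝ (Fin d))).norm
  simpa [Complex.norm_exp, ← Complex.ofReal_pow] using this

lemma integrable_gaussianDensity : Integrable (gaussianDensity d) := by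
  have := (integrable_exp_neg_mul_sq_norm (d := d) (b := 1 / 2) (by norm_num)).const_mul
    ((2 * π) ^ (-(d : ℝ) / 2))
  convert this using 2 with w
  simp only [gaussianDensity]
  ring_nf

lemma integrable_norm_mul_gaussianDensity :
    Integrable fun w : EuclideanSpace ℝ (Fin d) => ‖w‖ * gaussianDensity d w := by
  have := (integrable_exp_neg_mul_sq_norm (d := d) (b := 1 / 4) (by norm_num)).const_mul
    ((2 * π) ^ (-(d : ℝ) / 2))
  refine this.mono' ?_ (.of_forall fun w => ?_)
  · exact (continuous_norm.mul contDiff_gaussianDensity.continuous).aestronglyMeasurable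
  · rw [Real.norm_of_nonneg (mul_nonneg (norm_nonneg _) (gaussianDensity_nonneg w)),
      gaussianDensity, mul_left_comm]
    gcongr
    calc ‖w‖ * Real.exp (-‖w‖ ^ 2 / 2)
        ≤ Real.exp (‖w‖ ^ 2 / 4) * Real.exp (-‖w‖ ^ 2 / 2) := by
          gcongr
          nlinarith [Real.add_one_le_exp (‖w‖ ^ 2 / 4), sq_nonneg (‖w‖ / 2 - 1)]
      _ = Real.exp (-(1 / 4) * ‖w‖ ^ 2) := by rw [← Real.exp_add]; ring_nf

lemma integral_stdGaussian (f : EuclideanSpace ℝ (Fin d) → ℝ) :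
    ∫ w, f w ∂(stdGaussian d) = ∫ w, f w * gaussianDensity d w := by
  have hm : Measurable (gaussianDensity d) := contDiff_gaussianDensity.continuous.measurable
  change ∫ w, f w ∂(volume.withDensity fun w => ENNReal.ofReal (gaussianDensity d w)) = _
  rw [integral_withDensity_eq_integral_toReal_smul hm.ennreal_ofReal
    (.of_forall fun _ => ENNReal.ofReal_lt_top)]
  simp [ENNReal.toReal_ofReal (gaussianDensity_nonneg _), mul_comm]

lemma integral_abs_gaussianDensity_translate_sub_le (h : EuclideanSpace ℝ (Fin d)) :
    ∫ w, |gaussianDensity d (w + h) - gaussianDensity d w|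
      ≤ ‖h‖ * ∫ w, ‖w‖ ∂(stdGaussian d) := by
  have hnn (w : EuclideanSpace ℝ (Fin d)) : 0 ≤ ‖w‖ * gaussianDensity d w :=
    mul_nonneg (norm_nonneg _) (gaussianDensity_nonneg w)
  have hint := (integrable_gaussianDensity (d := d)).comp_add_right h |>.sub
    integrable_gaussianDensity
  have hle := (lintegral_enorm_translate_sub_le volume contDiff_gaussianDensity h).trans
    (mul_le_mul_right (lintegral_mono enorm_fderiv_gaussianDensity_le) _)
  rw [← ofReal_integral_eq_lintegral_ofReal integrable_norm_mul_gaussianDensity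
    (.of_forall hnn), ← integral_stdGaussian, ← ofReal_norm,
    ← ENNReal.ofReal_mul (norm_nonneg _)] at hle
  have hM : 0 ≤ ∫ w, ‖w‖ ∂(stdGaussian d) := integral_nonneg fun _ => norm_nonneg _
  rw [← ENNReal.ofReal_le_ofReal_iff (by positivity)]
  refine le_trans (le_of_eq ?_) hle
  exact ofReal_integral_norm_eq_lintegral_enorm hint

end GaussianDensity

section SmoothedKernel

variable {d : ℕ} {σ : ℝ} {𝒜 : Type*} [MeasurableSpace 𝒜]
  (p : ProbabilityTheory.Kernel (EuclideanSpace ℝ (Fin d)) 𝒜)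

lemma toReal_smoothedKernel_apply [ProbabilityTheory.IsMarkovKernel p]
    (c : EuclideanSpace ℝ (Fin d)) {A : Set 𝒜} (hA : MeasurableSet A) :
    (smoothedKernel d σ p c A).toReal
      = ∫ w, (p (c + σ • w) A).toReal * gaussianDensity d w := by
  have hs : Measurable fun w : EuclideanSpace ℝ (Fin d) => c + σ • w := by fun_prop
  have hp : Measurable fun w => p (c + σ • w) := p.measurable.comp hs
  have hpA : Measurable fun w => p (c + σ • w) A := (p.measurable_coe hA).comp hs
  rw [← integral_stdGaussian, smoothedKernel, Measure.bind_apply hA hp.aemeasurable,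
    integral_toReal hpA.aemeasurable (.of_forall fun _ => measure_lt_top _ _)]

lemma abs_smoothedKernel_sub_le [ProbabilityTheory.IsMarkovKernel p] (hσ : 0 < σ)
    (c c' : EuclideanSpace ℝ (Fin d)) {A : Set 𝒜} (hA : MeasurableSet A) :
    |(smoothedKernel d σ p c A).toReal - (smoothedKernel d σ p c' A).toReal|
      ≤ (∫ w, ‖w‖ ∂(stdGaussian d)) / σ * ‖c - c'‖ := by
  set h := σ⁻¹ • (c' - c) with hh
  have hshift (w : EuclideanSpace ℝ (Fin d)) : c + σ • (w + h) = c' + σ • w := by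
    rw [hh, smul_add, smul_inv_smul₀ hσ.ne']; abel
  let F (w : EuclideanSpace ℝ (Fin d)) : ℝ := (p (c' + σ • w) A).toReal
  have hF1 (w : EuclideanSpace ℝ (Fin d)) : ‖F w‖ ≤ 1 := by
    simpa [F, Measure.real] using measureReal_le_one (μ := p (c' + σ • w)) (s := A)
  have hFm : AEStronglyMeasurable F volume :=
    ((p.measurable_coe hA).comp
      (by fun_prop : Measurable fun w : EuclideanSpace ℝ (Fin d) => c' + σ • w)).ennreal_toReal.aestronglyMeasurable
  have hg := integrable_gaussianDensity (d := d)
  have hgh := hg.comp_add_right h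
  have hc : (smoothedKernel d σ p c A).toReal = ∫ w, F w * gaussianDensity d (w + h) := by
    rw [toReal_smoothedKernel_apply p c hA,
      ← integral_add_right_eq_self _ h]
    simp only [hshift, F]
  rw [hc, toReal_smoothedKernel_apply p c' hA, ← integral_sub
    (hgh.bdd_mul hFm (.of_forall hF1)) (hg.bdd_mul hFm (.of_forall hF1))]
  calc |∫ w, (F w * gaussianDensity d (w + h) - F w * gaussianDensity d w)|
      ≤ ∫ w, |gaussianDensity d (w + h) - gaussianDensity d w| := by
        rw [← Real.norm_eq_abs]
        refine norm_integral_le_of_norm_le (hgh.sub hg).abs (.of_forall fun w => ?_)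
        rw [← mul_sub, norm_mul]
        exact mul_le_of_le_one_left (abs_nonneg _) (hF1 w)
    _ ≤ ‖h‖ * ∫ w, ‖w‖ ∂(stdGaussian d) := integral_abs_gaussianDensity_translate_sub_le h
    _ = (∫ w, ‖w‖ ∂(stdGaussian d)) / σ * ‖c - c'‖ := by
        rw [hh, norm_smul, norm_inv, Real.norm_of_nonneg hσ.le, norm_sub_rev]
        ring

end SmoothedKernel

/-- **Theorem 1, overlap form.** Smoothing increases overlap across contexts:
`Ov(p_σ(·|c), p_σ(·|c')) ≥ 1 − (M_d / σ) · ‖c − c'‖`. In particular the lower bound is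
nondecreasing in `σ` for fixed contexts, and nonincreasing in `‖c − c'‖` for fixed `σ`. -/
theorem smoothing_overlap_lower_bound
    (d : ℕ) (hd : 1 ≤ d) {𝒜 : Type*} [MeasurableSpace 𝒜]
    (p : ProbabilityTheory.Kernel (EuclideanSpace ℝ (Fin d)) 𝒜)
    [ProbabilityTheory.IsMarkovKernel p]
    (σ : ℝ) (hσ : 0 < σ)
    (M : ℝ) (hM : M = ∫ w, ‖w‖ ∂(stdGaussian d)) :
    (∀ c c' : EuclideanSpace ℝ (Fin d),
      Ov (smoothedKernel d σ p c) (smoothedKernel d σ p c') ≥ 1 - (M / σ) * ‖c - c'‖) ∧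
    (∀ c c' : EuclideanSpace ℝ (Fin d), ∀ σ₁ σ₂ : ℝ, 0 < σ₁ → σ₁ ≤ σ₂ →
      1 - (M / σ₁) * ‖c - c'‖ ≤ 1 - (M / σ₂) * ‖c - c'‖) ∧
    (∀ r₁ r₂ : ℝ, 0 ≤ r₁ → r₁ ≤ r₂ → 1 - (M / σ) * r₂ ≤ 1 - (M / σ) * r₁) := by
  subst hM
  have hM0 : 0 ≤ ∫ w, ‖w‖ ∂(stdGaussian d) := integral_nonneg fun _ => norm_nonneg _
  refine ⟨fun c c' => ?_, fun c c' σ₁ σ₂ h₁ h₂ => ?_, fun r₁ r₂ _ h => ?_⟩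
  · have : Nonempty {A : Set 𝒜 // MeasurableSet A} := ⟨⟨∅, .empty⟩⟩
    exact sub_le_sub_left (ciSup_le fun A => abs_smoothedKernel_sub_le p hσ c c' A.2) 1
  · gcongr
  · gcongr
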